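/- In the semigroup of polynomials over ℚ under composition, the polynomials f(x) = 2x² and g(x) = x² generate a free semigroup on two generators; that is, two compositional words in f and g are equal as polynomials only if they are identical words. -/

import Mathlib

open Polynomial

/-- The value at `1` of a composition of copies of `2x²` and `x²` is a power of two. -/
theorem exists_eval_one_foldr_comp_eq_two_pow (l : List ℚ[X])
    (hl : ∀ q ∈ l, q = C 2 * X ^ 2 ∨ q = X ^ 2) :
    ∃ a : ℕ, (l.foldr comp X).eval 1 = 2 ^ a := by
  induction l with
  | nil => exact ⟨0, by simp⟩
  | cons q l ih =>
    obtain ⟨a, ha⟩ := ih fun p hp => hl p (List.mem_cons_of_mem _ hp)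
    rcases hl q List.mem_cons_self with rfl | rfl
    · exact ⟨2 * a + 1, by simp [ha]; ring⟩
    · exact ⟨2 * a, by simp [ha]; ring⟩

/-- A composition whose outermost factor is quadratic is not the identity. -/
theorem comp_ne_X_of_quadratic {q : ℚ[X]} (hq : q = C 2 * X ^ 2 ∨ q = X ^ 2) (p : ℚ[X]) :
    q.comp p ≠ X := by
  intro h
  have hdeg : q.natDegree = 2 := by
    rcases hq with rfl | rfl
    · exact natDegree_C_mul_X_pow 2 2 two_ne_zero
    · exact natDegree_X_pow 2
  have := congrArg natDegree h
  rw [natDegree_comp, hdeg, natDegree_X] at this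
  omega

theorem two_mul_two_pow_sq_ne_two_pow_sq (a b : ℕ) : (2 : ℚ) * (2 ^ a) ^ 2 ≠ (2 ^ b) ^ 2 := by
  intro h
  have h' : (2 : ℕ) ^ (2 * a + 1) = 2 ^ (2 * b) := by
    have : (2 : ℚ) ^ (2 * a + 1) = 2 ^ (2 * b) := by
      rw [pow_succ', mul_comm 2 a, mul_comm 2 b, pow_mul, pow_mul, h]
    exact_mod_cast this
  have := Nat.pow_right_injective le_rfl h'
  omega

theorem eq_of_sq_eq_sq_of_eval_one_pos {p r : ℚ[X]} (hp : 0 < p.eval 1) (hr : 0 < r.eval 1)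
    (h : p ^ 2 = r ^ 2) : p = r := by
  rcases sq_eq_sq_iff_eq_or_eq_neg.mp h with h | h
  · exact h
  · rw [h, eval_neg] at hp
    linarith

/-- Composition words in `2x²` and `x²`, the empty word included, are determined by their
values. -/
theorem eq_of_foldr_comp_eq (l₁ l₂ : List ℚ[X])
    (hmem₁ : ∀ q ∈ l₁, q = C 2 * X ^ 2 ∨ q = X ^ 2)
    (hmem₂ : ∀ q ∈ l₂, q = C 2 * X ^ 2 ∨ q = X ^ 2)
    (heq : l₁.foldr comp X = l₂.foldr comp X) : l₁ = l₂ := by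
  induction l₁ generalizing l₂ with
  | nil =>
    cases l₂ with
    | nil => rfl
    | cons r l₂ => exact absurd heq.symm (comp_ne_X_of_quadratic (hmem₂ r List.mem_cons_self) _)
  | cons q l₁ ih =>
    cases l₂ with
    | nil => exact absurd heq (comp_ne_X_of_quadratic (hmem₁ q List.mem_cons_self) _)
    | cons r l₂ =>
      have hl₁ : ∀ p ∈ l₁, p = C 2 * X ^ 2 ∨ p = X ^ 2 :=
        fun p hp => hmem₁ p (List.mem_cons_of_mem _ hp)
      have hl₂ : ∀ p ∈ l₂, p = C 2 * X ^ 2 ∨ p = X ^ 2 :=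
        fun p hp => hmem₂ p (List.mem_cons_of_mem _ hp)
      obtain ⟨a, ha⟩ := exists_eval_one_foldr_comp_eq_two_pow l₁ hl₁
      obtain ⟨b, hb⟩ := exists_eval_one_foldr_comp_eq_two_pow l₂ hl₂
      have tails_eq (h : l₁.foldr comp X ^ 2 = l₂.foldr comp X ^ 2) : l₁ = l₂ :=
        ih l₂ hl₁ hl₂ (eq_of_sq_eq_sq_of_eval_one_pos (by rw [ha]; positivity)
          (by rw [hb]; positivity) h)
      rw [List.foldr_cons, List.foldr_cons] at heq
      have heval := congrArg (eval 1) heq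
      rw [eval_comp, eval_comp, ha, hb] at heval
      rcases hmem₁ q List.mem_cons_self with rfl | rfl <;>
        rcases hmem₂ r List.mem_cons_self with rfl | rfl
      · rw [mul_comp, mul_comp, C_comp, C_comp, X_pow_comp, X_pow_comp] at heq
        rw [tails_eq (mul_left_cancel₀ (C_ne_zero.mpr two_ne_zero) heq)]
      · rw [eval_mul, eval_C, eval_X_pow, eval_X_pow] at heval
        exact absurd heval (two_mul_two_pow_sq_ne_two_pow_sq a b)
      · rw [eval_mul, eval_C, eval_X_pow, eval_X_pow] at heval
        exact absurd heval.symm (two_mul_two_pow_sq_ne_two_pow_sq b a)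
      · rw [X_pow_comp, X_pow_comp] at heq
        rw [tails_eq heq]

/-- The polynomials `2x²` and `x²` generate a free semigroup on two generators under
composition: two compositional words in them are equal as polynomials only if they are
identical words.  A word is encoded as a nonempty list of polynomials each of which is
`2x²` or `x²`, and its value is the composition of its entries. -/
theorem free_semigroup_two_x_sq_x_sq (l₁ l₂ : List (Polynomial ℚ))
    (h₁ : l₁ ≠ []) (h₂ : l₂ ≠ [])
    (hmem₁ : ∀ q ∈ l₁, q = C 2 * X ^ 2 ∨ q = X ^ 2)
    (hmem₂ : ∀ q ∈ l₂, q = C 2 * X ^ 2 ∨ q = X ^ 2)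
    (heq : l₁.foldr Polynomial.comp Polynomial.X = l₂.foldr Polynomial.comp Polynomial.X) :
    l₁ = l₂ := by
  exact eq_of_foldr_comp_eq l₁ l₂ hmem₁ hmem₂ heq
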